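/- Assume the demands d j (j ∈ Fin n) are pairwise distinct and let (A, B) be a clean optimal pair. Then for every real number t not equal to any b i or c i (i ∈ Fin n), the cardinalities |{i ∈ A : b i < t < c i}| and |{i ∈ B : b i < t < c i}| differ by at most 1. -/

import Mathlib

open Finset

noncomputable section

/-- Cost of the assignment `π` (customer `j` is assigned to supplier `π j`)
when the suppliers in `A` are upgraded. -/
def assignCost {n : ℕ} (b c d : Fin n → ℝ) (A : Finset (Fin n))
    (π : Equiv.Perm (Fin n)) : ℝ :=
  ∑ j, (if π j ∈ A then b (π j) else c (π j)) * d j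

/-- `cost A` : minimum assignment cost when upgrading the suppliers in `A`. -/
def cost {n : ℕ} (b c d : Fin n → ℝ) (A : Finset (Fin n)) : ℝ :=
  Finset.univ.inf' Finset.univ_nonempty (assignCost b c d A)

/-- The LP feasible region `P(k)`. -/
def Pk (n k : ℕ) : Set ((Fin n → Fin n → ℝ) × (Fin n → Fin n → ℝ)) :=
  {p | (∀ i j, 0 ≤ p.1 i j) ∧ (∀ i j, 0 ≤ p.2 i j) ∧
    (∀ j, ∑ i, (p.1 i j + p.2 i j) = 1) ∧
    (∀ i, ∑ j, (p.1 i j + p.2 i j) = 1) ∧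
    (∑ i, ∑ j, p.1 i j) ≤ (k : ℝ)}

/-- The LP objective. -/
def obj {n : ℕ} (b c d : Fin n → ℝ)
    (p : (Fin n → Fin n → ℝ) × (Fin n → Fin n → ℝ)) : ℝ :=
  ∑ i, ∑ j, (b i * p.1 i j + c i * p.2 i j) * d j

/-- A point is integral if all of its entries lie in `{0, 1}`. -/
def Integral {n : ℕ} (p : (Fin n → Fin n → ℝ) × (Fin n → Fin n → ℝ)) : Prop :=
  (∀ i j, p.1 i j = 0 ∨ p.1 i j = 1) ∧ (∀ i j, p.2 i j = 0 ∨ p.2 i j = 1)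

/-- `f_{A,B}(k)`. -/
def fpair {n : ℕ} (b c d : Fin n → ℝ) (k : ℕ) (A B : Finset (Fin n)) : ℝ :=
  (((B.card : ℝ) - k) * cost b c d A + ((k : ℝ) - A.card) * cost b c d B) /
    ((B.card : ℝ) - A.card)

/-- `(A, B)` is an optimal pair. -/
def OptimalPair {n : ℕ} (b c d : Fin n → ℝ) (k : ℕ) (A B : Finset (Fin n)) : Prop :=
  A.card < k ∧ k < B.card ∧ IsLeast (obj b c d '' Pk n k) (fpair b c d k A B)

/-- `X` is simple: some optimal assignment for upgrading `X` assigns every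
upgraded supplier to a customer with positive demand. -/
def SimpleSet {n : ℕ} (b c d : Fin n → ℝ) (X : Finset (Fin n)) : Prop :=
  ∃ π : Equiv.Perm (Fin n), assignCost b c d X π = cost b c d X ∧
    ∀ j, π j ∈ X → 0 < d j

/-- `(A, B)` is clean. -/
def Clean {n : ℕ} (b c : Fin n → ℝ) (A B : Finset (Fin n)) : Prop :=
  ∀ i ∈ symmDiff A B, ∀ i' ∈ symmDiff A B, ¬ (b i < b i' ∧ c i' < c i)

/-- `(A', B')` is a redistribution of `(A, B)` : the elements of `A ∆ B` are
enumerated `e 0, e 1, …` with `b` and `c` both nondecreasing along the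
enumeration, the elements with odd (0-based) index go to `A'` and those with
even (0-based) index go to `B'` (on top of `A ∩ B`). -/
def Redistribution {n : ℕ} (b c : Fin n → ℝ) (A B A' B' : Finset (Fin n)) : Prop :=
  ∃ (ℓ : ℕ) (e : Fin ℓ → Fin n), Function.Injective e ∧
    Finset.image e Finset.univ = symmDiff A B ∧
    Monotone (b ∘ e) ∧ Monotone (c ∘ e) ∧
    A' = (A ∩ B) ∪
      Finset.image e ((Finset.univ : Finset (Fin ℓ)).filter (fun s => (s : ℕ) % 2 = 1)) ∧
    B' = (A ∩ B) ∪
      Finset.image e ((Finset.univ : Finset (Fin ℓ)).filter (fun s => (s : ℕ) % 2 = 0))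

/-- The 0/1 point of the LP corresponding to assignment `π` with upgraded set `A`. -/
def chi {n : ℕ} (π : Equiv.Perm (Fin n)) (A : Finset (Fin n)) :
    (Fin n → Fin n → ℝ) × (Fin n → Fin n → ℝ) :=
  (fun i j => if π j = i ∧ i ∈ A then 1 else 0,
   fun i j => if π j = i ∧ i ∉ A then 1 else 0)

/-- `hval k'` : minimum of `cost X` over all `X` of cardinality `k'`. -/
def hval {n : ℕ} (b c d : Fin n → ℝ) (k' : ℕ) : ℝ :=
  sInf {v | ∃ X : Finset (Fin n), X.card = k' ∧ cost b c d X = v}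

end

/-- The cost of supplier `i` when the suppliers in `X` are upgraded. -/
noncomputable def effCost {n : ℕ} (b c : Fin n → ℝ) (X : Finset (Fin n)) (i : Fin n) : ℝ :=
  if i ∈ X then b i else c i

lemma assignCost_eq_sum_effCost {n : ℕ} (b c d : Fin n → ℝ) (X : Finset (Fin n))
    (π : Equiv.Perm (Fin n)) :
    assignCost b c d X π = ∑ j, effCost b c X (π j) * d j := rfl

lemma exists_assignCost_eq_cost {n : ℕ} (b c d : Fin n → ℝ) (X : Finset (Fin n)) :
    ∃ π, assignCost b c d X π = cost b c d X := by
  obtain ⟨π, -, h⟩ := Finset.exists_mem_eq_inf' (Finset.univ_nonempty) (assignCost b c d X)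
  exact ⟨π, h.symm⟩

lemma cost_le_assignCost {n : ℕ} (b c d : Fin n → ℝ) (X : Finset (Fin n))
    (π : Equiv.Perm (Fin n)) : cost b c d X ≤ assignCost b c d X π :=
  Finset.inf'_le _ (Finset.mem_univ π)

/-! ### Exchange property of optimal pairs -/

lemma chi_add {n : ℕ} (π : Equiv.Perm (Fin n)) (X : Finset (Fin n)) (i j : Fin n) :
    (chi π X).1 i j + (chi π X).2 i j = if π j = i then 1 else 0 := by
  by_cases h : π j = i <;> by_cases h' : i ∈ X <;> simp [chi, h, h']

lemma sum_chi_fst {n : ℕ} (π : Equiv.Perm (Fin n)) (X : Finset (Fin n)) :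
    ∑ i, ∑ j, (chi π X).1 i j = (X.card : ℝ) := by
  have h : ∀ i, ∑ j, (chi π X).1 i j = if i ∈ X then (1 : ℝ) else 0 := by
    intro i
    rw [Finset.sum_eq_single (π.symm i)]
    · simp [chi]
    · intro j _ hj
      have : π j ≠ i := fun h => hj (by simp [← h])
      simp [chi, this]
    · simp
  simp [h]

lemma obj_chi {n : ℕ} (b c d : Fin n → ℝ) (π : Equiv.Perm (Fin n)) (X : Finset (Fin n)) :
    obj b c d (chi π X) = assignCost b c d X π := by
  unfold obj assignCost
  rw [Finset.sum_comm]
  refine Finset.sum_congr rfl fun j _ => ?_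
  rw [Finset.sum_eq_single (π j)]
  · by_cases h : π j ∈ X <;> simp [chi, h]
  · intro i _ hi
    simp [chi, hi.symm]
  · simp

/-- A convex combination of integral points is feasible once its upgrade mass is at most `k`. -/
lemma sum_smul_chi_mem_Pk {n k : ℕ} {ι : Type*} [Fintype ι] (w : ι → ℝ) (hw : ∀ a, 0 ≤ w a)
    (hw1 : ∑ a, w a = 1) (X : ι → Finset (Fin n)) (π : ι → Equiv.Perm (Fin n))
    (hk : ∑ a, w a * ((X a).card : ℝ) ≤ k) :
    ((fun i j => ∑ a, w a * (chi (π a) (X a)).1 i j,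
      fun i j => ∑ a, w a * (chi (π a) (X a)).2 i j) :
      (Fin n → Fin n → ℝ) × (Fin n → Fin n → ℝ)) ∈ Pk n k := by
  refine ⟨fun i j => ?_, fun i j => ?_, fun j => ?_, fun i => ?_, ?_⟩
  · refine Finset.sum_nonneg fun a _ => mul_nonneg (hw a) ?_
    simp only [chi]; split_ifs <;> norm_num
  · refine Finset.sum_nonneg fun a _ => mul_nonneg (hw a) ?_
    simp only [chi]; split_ifs <;> norm_num
  · simp only [← Finset.sum_add_distrib, ← mul_add, chi_add]
    rw [Finset.sum_comm]
    simpa using hw1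
  · simp only [← Finset.sum_add_distrib, ← mul_add, chi_add]
    rw [Finset.sum_comm]
    have : ∀ a, ∑ j, w a * (if π a j = i then (1 : ℝ) else 0) = w a := by
      intro a
      simp [← Equiv.eq_symm_apply]
    simpa only [this] using hw1
  · refine le_trans (le_of_eq ?_) hk
    calc ∑ i, ∑ j, ∑ a, w a * (chi (π a) (X a)).1 i j
        = ∑ i, ∑ a, ∑ j, w a * (chi (π a) (X a)).1 i j :=
          Finset.sum_congr rfl fun i _ => Finset.sum_comm
      _ = ∑ a, ∑ i, ∑ j, w a * (chi (π a) (X a)).1 i j := Finset.sum_comm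
      _ = ∑ a, w a * ((X a).card : ℝ) := by
          refine Finset.sum_congr rfl fun a _ => ?_
          rw [← sum_chi_fst (π a) (X a)]
          simp only [Finset.mul_sum]

lemma obj_sum_smul {n : ℕ} (b c d : Fin n → ℝ) {ι : Type*} [Fintype ι] (w : ι → ℝ)
    (p : ι → (Fin n → Fin n → ℝ) × (Fin n → Fin n → ℝ)) :
    obj b c d (fun i j => ∑ a, w a * (p a).1 i j, fun i j => ∑ a, w a * (p a).2 i j) =
      ∑ a, w a * obj b c d (p a) := by
  unfold obj
  simp only [Finset.mul_sum]
  rw [Finset.sum_comm]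
  conv_rhs => rw [Finset.sum_comm]
  rw [Finset.sum_comm]
  refine Finset.sum_congr rfl fun i _ => ?_
  rw [Finset.sum_comm]
  refine Finset.sum_congr rfl fun j _ => ?_
  rw [← Finset.sum_add_distrib, Finset.sum_mul]
  exact Finset.sum_congr rfl fun a _ => by ring

lemma OptimalPair.cost_add_cost_le {n k : ℕ} {b c d : Fin n → ℝ} {A B A' B' : Finset (Fin n)}
    (h : OptimalPair b c d k A B) (hcard : A'.card + B'.card = A.card + B.card) :
    cost b c d A + cost b c d B ≤ cost b c d A' + cost b c d B' := by
  obtain ⟨hA, hB, -, hmin⟩ := h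
  have hA' : (A.card : ℝ) < k := by exact_mod_cast hA
  have hB' : (k : ℝ) < B.card := by exact_mod_cast hB
  have hcard' : (A'.card : ℝ) + B'.card = A.card + B.card := by exact_mod_cast hcard
  have hpos : (0 : ℝ) < B.card - A.card := by linarith
  set μ : ℝ := ((B.card : ℝ) - k) / (B.card - A.card) with hμ
  set ν : ℝ := ((k : ℝ) - A.card) / (B.card - A.card) with hν
  have hμ0 : 0 < μ := div_pos (by linarith) hpos
  have hν0 : 0 < ν := div_pos (by linarith) hpos
  have hsum : μ + ν = 1 := by rw [hμ, hν]; field_simp; ring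
  have hmass : μ * A.card + ν * B.card = k := by rw [hμ, hν]; field_simp; ring
  have hf : fpair b c d k A B = μ * cost b c d A + ν * cost b c d B := by
    rw [fpair, hμ, hν]; ring
  obtain ⟨ε, hε, hεm⟩ : ∃ ε : ℝ, 0 < ε ∧ ε ≤ μ ∧ ε ≤ ν :=
    ⟨min μ ν, lt_min hμ0 hν0, min_le_left _ _, min_le_right _ _⟩
  obtain ⟨πA, eA⟩ := exists_assignCost_eq_cost b c d A
  obtain ⟨πB, eB⟩ := exists_assignCost_eq_cost b c d B
  obtain ⟨πA', eA'⟩ := exists_assignCost_eq_cost b c d A'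
  obtain ⟨πB', eB'⟩ := exists_assignCost_eq_cost b c d B'
  have hmem := sum_smul_chi_mem_Pk (k := k) ![μ - ε, ν - ε, ε, ε]
    (by
      intro a
      fin_cases a
      · exact sub_nonneg.2 hεm.1
      · exact sub_nonneg.2 hεm.2
      · exact hε.le
      · exact hε.le)
    (by simp [Fin.sum_univ_four]; linarith) ![A, B, A', B'] ![πA, πB, πA', πB']
    (by
      simp only [Fin.sum_univ_four, Matrix.cons_val]
      apply le_of_eq
      linear_combination hmass + ε * hcard')
  have key := hmin (Set.mem_image_of_mem (obj b c d) hmem)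
  rw [obj_sum_smul b c d ![μ - ε, ν - ε, ε, ε]
    (fun a => chi (![πA, πB, πA', πB'] a) (![A, B, A', B'] a))] at key
  simp only [Fin.sum_univ_four, Matrix.cons_val, obj_chi, eA, eB, eA', eB', hf] at key
  have : 0 ≤ ε * (cost b c d A' + cost b c d B' - (cost b c d A + cost b c d B)) := by
    linarith
  linarith [nonneg_of_mul_nonneg_right this hε]

/-! ### Layer-cake formula for the cost -/

lemma sum_range_card_le_sum {n : ℕ} {D : ℕ → ℝ} (hD : MonotoneOn D (Set.Iio n)) :
    ∀ T : Finset ℕ, T ⊆ Finset.range n → ∑ k ∈ Finset.range T.card, D k ≤ ∑ k ∈ T, D k := by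
  intro T
  induction T using Finset.induction_on_max with
  | empty => simp
  | insert a T ha ih =>
    intro hT
    have haT : a ∉ T := fun h => lt_irrefl _ (ha a h)
    rw [Finset.card_insert_of_notMem haT, Finset.sum_range_succ, Finset.sum_insert haT, add_comm]
    have han : a < n := Finset.mem_range.1 (hT (Finset.mem_insert_self _ _))
    have hTa : T.card ≤ a := by
      simpa using Finset.card_le_card (fun x hx => Finset.mem_range.2 (ha x hx) :
        T ⊆ Finset.range a)
    exact add_le_add (hD (lt_of_le_of_lt hTa han) han hTa)
      (ih fun x hx => hT (Finset.mem_insert_of_mem hx))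

/-- Balancedness inequality for the partial sums of a strictly increasing sequence. -/
lemma sum_range_add_sum_range_lt {n : ℕ} {D : ℕ → ℝ} (hD : StrictMonoOn D (Set.Iio n))
    {p p' q' r : ℕ} (hpq : p < q') (hr : 0 < r) (hn : q' + r ≤ n) (hp' : p' = p + r) :
    ∑ k ∈ Finset.range p', D k + ∑ k ∈ Finset.range q', D k <
      ∑ k ∈ Finset.range p, D k + ∑ k ∈ Finset.range (q' + r), D k := by
  subst hp'
  rw [Finset.sum_range_add, Finset.sum_range_add]
  have : ∑ x ∈ Finset.range r, D (p + x) < ∑ x ∈ Finset.range r, D (q' + x) := by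
    refine Finset.sum_lt_sum_of_nonempty (by simpa using hr.ne') fun x hx => ?_
    have := Finset.mem_range.1 hx
    exact hD (by simp only [Set.mem_Iio]; omega) (by simp only [Set.mem_Iio]; omega) (by omega)
  linarith

lemma sum_range_add_sum_range_balanced_lt {n : ℕ} {D : ℕ → ℝ} (hD : StrictMonoOn D (Set.Iio n))
    {p q p' q' : ℕ} (hsum : p' + q' = p + q) (h1 : p' ≤ q' + 1) (h2 : q' ≤ p' + 1)
    (hp : p ≤ n) (hq : q ≤ n) (hne : p + 2 ≤ q ∨ q + 2 ≤ p) :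
    ∑ k ∈ Finset.range p', D k + ∑ k ∈ Finset.range q', D k <
      ∑ k ∈ Finset.range p, D k + ∑ k ∈ Finset.range q, D k := by
  rcases hne with h | h
  · have := sum_range_add_sum_range_lt hD (p := p) (p' := p') (q' := q') (r := q - q')
      (by omega) (by omega) (by omega) (by omega)
    rwa [show q' + (q - q') = q by omega] at this
  · have := sum_range_add_sum_range_lt hD (p := q) (p' := q') (q' := p') (r := p - p')
      (by omega) (by omega) (by omega) (by omega)
    rw [show p' + (p - p') = p by omega] at this
    linarith

lemma sum_range_add_sum_range_balanced_le {n : ℕ} {D : ℕ → ℝ} (hD : StrictMonoOn D (Set.Iio n))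
    {p q p' q' : ℕ} (hsum : p' + q' = p + q) (h1 : p' ≤ q' + 1) (h2 : q' ≤ p' + 1)
    (hp : p ≤ n) (hq : q ≤ n) :
    ∑ k ∈ Finset.range p', D k + ∑ k ∈ Finset.range q', D k ≤
      ∑ k ∈ Finset.range p, D k + ∑ k ∈ Finset.range q, D k := by
  by_cases hne : p + 2 ≤ q ∨ q + 2 ≤ p
  · exact (sum_range_add_sum_range_balanced_lt hD hsum h1 h2 hp hq hne).le
  · obtain ⟨rfl, rfl⟩ | ⟨rfl, rfl⟩ : (p' = p ∧ q' = q) ∨ (p' = q ∧ q' = p) := by omega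
    · exact le_rfl
    · rw [add_comm]

/-- The indices satisfying a downward closed condition form an initial segment. -/
lemma exists_filter_range_eq_range (p : ℕ → Prop) [DecidablePred p] (m : ℕ)
    (hp : ∀ k l, k ≤ l → l < m → p l → p k) :
    ∃ r, (Finset.range m).filter p = Finset.range r := by
  induction m with
  | zero => exact ⟨0, by simp⟩
  | succ m ih =>
    by_cases hm : p m
    · refine ⟨m + 1, Finset.filter_true_of_mem fun k hk => ?_⟩
      exact hp k m (Nat.lt_succ_iff.1 (Finset.mem_range.1 hk)) (Nat.lt_succ_self m) hm
    · obtain ⟨r, hr⟩ := ih fun k l hkl hl => hp k l hkl (hl.trans (Nat.lt_succ_self m))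
      exact ⟨r, by rw [Finset.range_add_one, Finset.filter_insert, if_neg hm, hr]⟩

/-- Sum of the demands of the customers served at a cost above `s`. -/
noncomputable def demandAbove {n : ℕ} (e d : Fin n → ℝ) (s : ℝ) : ℝ :=
  ∑ j, if s < e j then d j else 0

lemma demandAbove_antitone {n : ℕ} (e d : Fin n → ℝ) (hd : ∀ j, 0 ≤ d j) :
    Antitone (demandAbove e d) := by
  intro s s' hs
  refine Finset.sum_le_sum fun j _ => ?_
  split_ifs with h1 h2
  · exact le_rfl
  · exact absurd (hs.trans_lt h1) h2
  · exact hd j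
  · exact le_rfl

lemma integral_ite_lt {e M x : ℝ} (h0 : 0 ≤ e) (hM : e ≤ M) :
    IntervalIntegrable (fun s => if s < e then x else 0) MeasureTheory.volume 0 M ∧
      ∫ s in (0 : ℝ)..M, (if s < e then x else 0) = e * x := by
  have hA : IntervalIntegrable (fun s => if s < e then x else 0) MeasureTheory.volume 0 e := by
    refine (intervalIntegrable_const (c := x)).congr_ae ?_
    rw [Set.uIoc_of_le h0, ← MeasureTheory.restrict_Ioo_eq_restrict_Ioc]
    filter_upwards [MeasureTheory.ae_restrict_mem measurableSet_Ioo] with s hs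
    simp [hs.2]
  have hB : Set.EqOn (fun s => if s < e then x else 0) (fun _ => (0 : ℝ)) (Set.uIcc e M) := by
    intro s hs
    rw [Set.uIcc_of_le hM] at hs
    simp [hs.1]
  have hB' : IntervalIntegrable (fun s => if s < e then x else 0) MeasureTheory.volume e M :=
    (intervalIntegrable_const (c := (0 : ℝ))).congr fun s hs =>
      (hB (Set.uIoc_subset_uIcc hs)).symm
  refine ⟨hA.trans hB', ?_⟩
  rw [← intervalIntegral.integral_add_adjacent_intervals hA hB',
    intervalIntegral.integral_congr hB]
  have : ∫ s in (0 : ℝ)..e, (if s < e then x else 0) = ∫ s in (0 : ℝ)..e, x := by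
    apply intervalIntegral.integral_congr_ae'
    · have : ∀ᵐ s : ℝ, s ≠ e := by simp [MeasureTheory.ae_iff]
      filter_upwards [this] with s hs h
      simp [lt_of_le_of_ne h.2 hs]
    · filter_upwards with s h
      exact absurd (h.1.trans_le h.2) (not_lt.2 h0)
  simp [this]

lemma sum_mul_eq_integral {n : ℕ} (e d : Fin n → ℝ) {M : ℝ} (h0 : ∀ j, 0 ≤ e j)
    (hM : ∀ j, e j ≤ M) :
    ∑ j, e j * d j = ∫ s in (0 : ℝ)..M, demandAbove e d s := by
  unfold demandAbove
  rw [intervalIntegral.integral_finsetSum fun j _ => (integral_ite_lt (h0 j) (hM j)).1]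
  exact Finset.sum_congr rfl fun j _ => (integral_ite_lt (h0 j) (hM j)).2.symm

/-- Number of suppliers of cost above `s`. -/
noncomputable def numAbove {n : ℕ} (e : Fin n → ℝ) (s : ℝ) : ℕ :=
  (Finset.univ.filter fun i => s < e i).card

lemma numAbove_le {n : ℕ} (e : Fin n → ℝ) (s : ℝ) : numAbove e s ≤ n := by
  simpa [numAbove] using Finset.card_le_univ (Finset.univ.filter fun i => s < e i)

lemma numAbove_antitone {n : ℕ} (e : Fin n → ℝ) : Antitone (numAbove e) := fun _ _ hs =>
  Finset.card_le_card (Finset.monotone_filter_right _ fun _ _ h => hs.trans_lt h)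

lemma numAbove_comp_perm {n : ℕ} (e : Fin n → ℝ) (π : Equiv.Perm (Fin n)) (s : ℝ) :
    numAbove (e ∘ π) s = numAbove e s := by
  simp only [numAbove, Finset.card_filter]
  exact Equiv.sum_comp π fun i => if s < e i then 1 else 0

lemma demandAbove_eq_sum_map {n : ℕ} (e d : Fin n → ℝ) {D : ℕ → ℝ} (hD : ∀ k : Fin n, D k = d k)
    (s : ℝ) : demandAbove e d s =
      ∑ k ∈ (Finset.univ.filter fun i => s < e i).map Fin.valEmbedding, D k := by
  simp [demandAbove, Finset.sum_filter, hD]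

lemma sum_range_numAbove_le {n : ℕ} (e d : Fin n → ℝ) {D : ℕ → ℝ} (hD : ∀ k : Fin n, D k = d k)
    (hmono : MonotoneOn D (Set.Iio n)) (s : ℝ) :
    ∑ k ∈ Finset.range (numAbove e s), D k ≤ demandAbove e d s := by
  rw [demandAbove_eq_sum_map e d hD]
  have := sum_range_card_le_sum hmono ((Finset.univ.filter fun i => s < e i).map Fin.valEmbedding)
    (by intro x hx; simp only [Finset.mem_map] at hx; obtain ⟨y, -, rfl⟩ := hx; simp)
  rwa [Finset.card_map] at this

lemma demandAbove_eq_of_antitone {n : ℕ} (e d : Fin n → ℝ) {D : ℕ → ℝ}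
    (hD : ∀ k : Fin n, D k = d k) (he : Antitone e) (s : ℝ) :
    demandAbove e d s = ∑ k ∈ Finset.range (numAbove e s), D k := by
  classical
  rw [demandAbove_eq_sum_map e d hD]
  obtain ⟨r, hr⟩ := exists_filter_range_eq_range (fun k => ∃ h : k < n, s < e ⟨k, h⟩) n
    (by
      rintro k l hkl - ⟨hl, h⟩
      exact ⟨hkl.trans_lt hl, h.trans_le (he hkl)⟩)
  have hmap : (Finset.univ.filter fun i => s < e i).map Fin.valEmbedding = Finset.range r := by
    rw [← hr]
    ext k
    simp only [Finset.mem_map, Finset.mem_filter, Finset.mem_univ, true_and, Finset.mem_range,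
      Fin.valEmbedding_apply]
    constructor
    · rintro ⟨i, hi, rfl⟩
      exact ⟨i.2, i.2, hi⟩
    · rintro ⟨-, h, hk⟩
      exact ⟨⟨k, h⟩, hk, rfl⟩
  have hcard : numAbove e s = r := by
    rw [numAbove, ← Finset.card_map Fin.valEmbedding, hmap, Finset.card_range]
  rw [hmap, hcard]

lemma sum_range_numAbove_antitone {n : ℕ} (e : Fin n → ℝ) {D : ℕ → ℝ} (hD0 : ∀ k, 0 ≤ D k) :
    Antitone fun s => ∑ k ∈ Finset.range (numAbove e s), D k := fun _ _ hs =>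
  Finset.sum_le_sum_of_subset_of_nonneg
    (Finset.range_mono (numAbove_antitone e hs)) fun k _ _ => hD0 k

/-- The minimum assignment cost integrates, over the cost levels `s`, the total of the smallest
demands, as many as there are suppliers of cost above `s`. -/
lemma cost_eq_integral {n : ℕ} (b c d : Fin n → ℝ) (X : Finset (Fin n)) {M : ℝ}
    (h0 : ∀ i, 0 ≤ effCost b c X i) (hM : ∀ i, effCost b c X i ≤ M) {D : ℕ → ℝ}
    (hD0 : ∀ k, 0 ≤ D k) (hmono : MonotoneOn D (Set.Iio n)) (σ : Equiv.Perm (Fin n))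
    (hD : ∀ k : Fin n, D k = d (σ k)) (hM0 : 0 ≤ M) :
    cost b c d X =
      ∫ s in (0 : ℝ)..M, ∑ k ∈ Finset.range (numAbove (effCost b c X) s), D k := by
  have hrepr : ∀ π : Equiv.Perm (Fin n), assignCost b c d X π =
      ∫ s in (0 : ℝ)..M, demandAbove (effCost b c X ∘ (σ.trans π)) (d ∘ σ) s := by
    intro π
    rw [← sum_mul_eq_integral (effCost b c X ∘ (σ.trans π)) (d ∘ σ) (fun j => h0 _) (fun j => hM _),
      assignCost_eq_sum_effCost]
    exact (Equiv.sum_comp σ fun j => effCost b c X (π j) * d j).symm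
  apply le_antisymm
  · set τ := Tuple.sort (fun i => - effCost b c X i) with hτ
    have hanti : Antitone (effCost b c X ∘ τ) := by
      intro i j hij
      have := Tuple.monotone_sort (fun i => - effCost b c X i) hij
      simpa using this
    refine (cost_le_assignCost b c d X (σ.symm.trans τ)).trans (le_of_eq ?_)
    rw [hrepr, ← Equiv.trans_assoc, Equiv.self_trans_symm, Equiv.refl_trans]
    refine intervalIntegral.integral_congr fun s _ => ?_
    rw [demandAbove_eq_of_antitone _ (d ∘ σ) hD hanti, numAbove_comp_perm]
  · obtain ⟨π, hπ⟩ := exists_assignCost_eq_cost b c d X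
    rw [← hπ, hrepr]
    refine intervalIntegral.integral_mono_on hM0
      (sum_range_numAbove_antitone _ hD0).intervalIntegrable
      (demandAbove_antitone _ _ fun j => ?_).intervalIntegrable fun s _ => ?_
    · rw [Function.comp_apply, ← hD]
      exact hD0 _
    · rw [← numAbove_comp_perm _ (σ.trans π)]
      exact sum_range_numAbove_le _ (d ∘ σ) hD hmono s

/-! ### Balanced redistribution of a clean pair -/

lemma sum_neg_one_pow_mem_of_antitone (p : ℕ → Prop) [DecidablePred p] (m : ℕ)
    (hp : ∀ k l, k ≤ l → l < m → p l → p k) :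
    0 ≤ (∑ k ∈ Finset.range m, if p k then (-1 : ℤ) ^ k else 0) ∧
      (∑ k ∈ Finset.range m, if p k then (-1 : ℤ) ^ k else 0) ≤ 1 := by
  obtain ⟨r, hr⟩ := exists_filter_range_eq_range p m hp
  rw [← Finset.sum_filter, hr, neg_one_geom_sum]
  split_ifs <;> simp

/-- Alternating signs along a monotone chain of intervals are balanced at every level. -/
lemma abs_alternating_sum_le_one {m : ℕ} {u v : Fin m → ℝ} (hu : Monotone u) (hv : Monotone v)
    (huv : ∀ k, u k ≤ v k) (s : ℝ) :
    |∑ k : Fin m, if u k ≤ s ∧ s < v k then (-1 : ℤ) ^ (k : ℕ) else 0| ≤ 1 := by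
  classical
  have key : ∀ w : Fin m → ℝ, Monotone w →
      0 ≤ (∑ k : Fin m, if w k ≤ s then (-1 : ℤ) ^ (k : ℕ) else 0) ∧
      (∑ k : Fin m, if w k ≤ s then (-1 : ℤ) ^ (k : ℕ) else 0) ≤ 1 := by
    intro w hw
    have := sum_neg_one_pow_mem_of_antitone (fun k => ∃ h : k < m, w ⟨k, h⟩ ≤ s) m
      (by
        rintro k l hkl - ⟨hl, h⟩
        exact ⟨hkl.trans_lt hl, (hw hkl).trans h⟩)
    rw [Finset.sum_range] at this
    simpa using this
  have hsub : (∑ k : Fin m, if u k ≤ s ∧ s < v k then (-1 : ℤ) ^ (k : ℕ) else 0) =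
      (∑ k : Fin m, if u k ≤ s then (-1 : ℤ) ^ (k : ℕ) else 0) -
      ∑ k : Fin m, if v k ≤ s then (-1 : ℤ) ^ (k : ℕ) else 0 := by
    rw [← Finset.sum_sub_distrib]
    refine Finset.sum_congr rfl fun k _ => ?_
    by_cases h1 : v k ≤ s
    · simp [h1, (huv k).trans h1]
    · simp [h1, not_le.1 h1]
  rw [hsub, abs_le]
  have h1 := key u hu
  have h2 := key v hv
  constructor <;> linarith [h1.1, h1.2, h2.1, h2.2]

lemma exists_monotone_enumeration {n : ℕ} {b c : Fin n → ℝ} {E : Finset (Fin n)}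
    (hE : ∀ i ∈ E, ∀ i' ∈ E, ¬ (b i < b i' ∧ c i' < c i)) :
    ∃ e : Fin E.card ↪ Fin n, Finset.univ.map e = E ∧ Monotone (b ∘ e) ∧ Monotone (c ∘ e) := by
  set e₀ := E.orderEmbOfFin rfl
  set key : Fin E.card → ℝ ×ₗ ℝ := fun k => toLex (b (e₀ k), c (e₀ k)) with hkey
  set τ := Tuple.sort key
  have hmono : Monotone (key ∘ τ) := Tuple.monotone_sort key
  have hmem : ∀ k, e₀ k ∈ E := fun k => E.orderEmbOfFin_mem rfl k
  have hcmp : ∀ k l, k ≤ l → b (e₀ (τ k)) < b (e₀ (τ l)) ∨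
      b (e₀ (τ k)) = b (e₀ (τ l)) ∧ c (e₀ (τ k)) ≤ c (e₀ (τ l)) := fun k l hkl => by
    simpa [hkey, Prod.Lex.toLex_le_toLex] using hmono hkl
  refine ⟨τ.toEmbedding.trans e₀.toEmbedding, ?_, fun k l hkl => ?_, fun k l hkl => ?_⟩
  · rw [← Finset.map_map, Finset.map_univ_equiv]
    exact Finset.map_orderEmbOfFin_univ E rfl
  · rcases hcmp k l hkl with h | h
    · exact h.le
    · exact h.1.le
  · rcases hcmp k l hkl with h | h
    · by_contra hlt
      exact hE _ (hmem (τ k)) _ (hmem (τ l)) ⟨h, not_le.1 hlt⟩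
    · exact h.2

lemma exists_balanced_subset {n : ℕ} {b c : Fin n → ℝ} (hbc : ∀ i, b i ≤ c i)
    {E : Finset (Fin n)} (hE : ∀ i ∈ E, ∀ i' ∈ E, ¬ (b i < b i' ∧ c i' < c i)) :
    ∃ E₁ ⊆ E, ∀ s : ℝ,
      |∑ i ∈ E, if b i ≤ s ∧ s < c i then (if i ∈ E₁ then (1 : ℤ) else -1) else 0| ≤ 1 := by
  obtain ⟨e, he, hb, hc⟩ := exists_monotone_enumeration hE
  refine ⟨(Finset.univ.filter fun k : Fin E.card => Even (k : ℕ)).map e, ?_, fun s => ?_⟩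
  · exact (Finset.map_subset_map.2 (Finset.filter_subset _ _)).trans he.subset
  · refine le_of_eq_of_le ?_ (abs_alternating_sum_le_one hb hc (fun k => hbc (e k)) s)
    congr 1
    rw [← Finset.sum_congr he fun _ _ => rfl, Finset.sum_map]
    refine Finset.sum_congr rfl fun k _ => ?_
    have : e k ∈ (Finset.univ.filter fun k : Fin E.card => Even (k : ℕ)).map e ↔
        Even (k : ℕ) := by simp
    simp only [this, Function.comp_apply]
    by_cases hk : Even (k : ℕ)
    · simp [hk, hk.neg_one_pow]
    · simp [hk, (Nat.not_even_iff_odd.1 hk).neg_one_pow]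

/-- Number of suppliers of `X` whose half-open interval `[b i, c i)` contains `s`. -/
noncomputable def coverNum {n : ℕ} (b c : Fin n → ℝ) (X : Finset (Fin n)) (s : ℝ) : ℕ :=
  (X.filter fun i => b i ≤ s ∧ s < c i).card

lemma Clean.exists_balanced {n : ℕ} {b c : Fin n → ℝ} (hbc : ∀ i, b i ≤ c i)
    {A B : Finset (Fin n)} (h : Clean b c A B) :
    ∃ A' B' : Finset (Fin n), A'.card + B'.card = A.card + B.card ∧
      ∀ s, coverNum b c A' s + coverNum b c B' s = coverNum b c A s + coverNum b c B s ∧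
        |(coverNum b c A' s : ℤ) - coverNum b c B' s| ≤ 1 := by
  obtain ⟨E₁, hE₁, hbal⟩ := exists_balanced_subset hbc h
  have hcount : ∀ (P : Fin n → Prop) [DecidablePred P] (X : Finset (Fin n)),
      (X.filter P).card = ∑ i, if P i ∧ i ∈ X then 1 else 0 := by
    intro P _ X
    rw [← Finset.card_filter]
    congr 1
    ext i
    simp [and_comm]
  have hadd : ∀ (P : Fin n → Prop) [DecidablePred P],
      ((A ∩ B ∪ E₁).filter P).card + ((A ∩ B ∪ symmDiff A B \ E₁).filter P).card =
        (A.filter P).card + (B.filter P).card := by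
    intro P _
    simp only [hcount, ← Finset.sum_add_distrib]
    refine Finset.sum_congr rfl fun i _ => ?_
    have hi := @hE₁ i
    simp only [Finset.mem_symmDiff] at hi
    by_cases hP : P i <;> by_cases hA : i ∈ A <;> by_cases hB : i ∈ B <;>
      by_cases hE : i ∈ E₁ <;> simp_all [Finset.mem_symmDiff]
  refine ⟨A ∩ B ∪ E₁, A ∩ B ∪ symmDiff A B \ E₁, ?_, fun s => ⟨hadd _, ?_⟩⟩
  · simpa using hadd fun _ => True
  · refine le_of_eq_of_le ?_ (hbal s)
    congr 1
    simp only [coverNum, hcount]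
    clear hadd hcount
    push_cast
    rw [← Finset.sum_sub_distrib, ← Finset.sum_subset (Finset.subset_univ (symmDiff A B))]
    · refine Finset.sum_congr rfl fun i hi => ?_
      simp only [Finset.mem_union, Finset.mem_inter, Finset.mem_sdiff, hi, true_and]
      rw [Finset.mem_symmDiff] at hi
      grind
    · intro i _ hi
      have h1 : i ∉ E₁ := fun h => hi (hE₁ h)
      simp [h1, hi]

lemma numAbove_add_coverNum {n : ℕ} {b c : Fin n → ℝ} (hbc : ∀ i, b i ≤ c i)
    (X : Finset (Fin n)) (s : ℝ) :
    numAbove (effCost b c X) s + coverNum b c X s = numAbove c s := by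
  rw [numAbove, coverNum, numAbove, ← Finset.card_union_of_disjoint]
  · congr 1
    ext i
    have := hbc i
    simp only [Finset.mem_union, Finset.mem_filter, Finset.mem_univ, true_and, effCost]
    grind
  · rw [Finset.disjoint_left]
    intro i
    simp only [Finset.mem_filter, effCost]
    grind

/-! ### Comparison of costs -/

lemma exists_gt_numAbove_eq {n : ℕ} (b c : Fin n → ℝ) (t : ℝ) :
    ∃ t', t < t' ∧ ∀ s, t ≤ s → s < t' → ∀ X, numAbove (effCost b c X) s =
      numAbove (effCost b c X) t := by
  have h : ∀ᶠ t' in nhdsWithin t (Set.Ioi t), ∀ i,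
      (t < b i → t' < b i) ∧ (t < c i → t' < c i) := by
    rw [Filter.eventually_all]
    intro i
    refine Filter.Eventually.filter_mono nhdsWithin_le_nhds ?_
    have key : ∀ x : ℝ, ∀ᶠ t' in nhds t, t < x → t' < x := by
      intro x
      by_cases hx : t < x
      · filter_upwards [eventually_lt_nhds hx] with t' ht' _ using ht'
      · exact Filter.Eventually.of_forall fun t' h => absurd h hx
    exact (key (b i)).and (key (c i))
  obtain ⟨t', ht', htt'⟩ := (h.and self_mem_nhdsWithin).exists
  refine ⟨t', htt', fun s hs hs' X => ?_⟩
  unfold numAbove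
  congr 1
  refine Finset.filter_congr fun i _ => ⟨fun h => hs.trans_lt h, fun h => ?_⟩
  have := ht' i
  unfold effCost at h ⊢
  split_ifs at h ⊢
  · exact hs'.trans (this.1 h)
  · exact hs'.trans (this.2 h)

lemma integral_lt_integral_of_le_of_lt_const {f g : ℝ → ℝ} {M t t' x y : ℝ}
    (hf : IntervalIntegrable f MeasureTheory.volume 0 M)
    (hg : IntervalIntegrable g MeasureTheory.volume 0 M) (hfg : ∀ s, f s ≤ g s)
    (ht : 0 ≤ t) (htt' : t < t') (ht'M : t' ≤ M) (hxy : x < y)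
    (hx : ∀ s, t ≤ s → s < t' → f s = x) (hy : ∀ s, t ≤ s → s < t' → g s = y) :
    ∫ s in (0 : ℝ)..M, f s < ∫ s in (0 : ℝ)..M, g s := by
  have hM : (0 : ℝ) ≤ M := by linarith
  refine intervalIntegral.integral_lt_integral_of_ae_le_of_measure_setOfPred_lt_ne_zero hM hf hg
    (Filter.Eventually.of_forall hfg) (ne_of_gt ?_)
  have hsub : Set.Ioo t t' ⊆ Set.Ioc 0 M := fun s hs =>
    ⟨ht.trans_lt hs.1, hs.2.le.trans ht'M⟩
  have hlt : Set.Ioo t t' ⊆ {s | f s < g s} := fun s hs => by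
    simpa [hx s hs.1.le hs.2, hy s hs.1.le hs.2] using hxy
  calc (0 : ENNReal) < MeasureTheory.volume (Set.Ioo t t') := by simpa using htt'
    _ = MeasureTheory.volume.restrict (Set.Ioc 0 M) (Set.Ioo t t') := by
      rw [MeasureTheory.Measure.restrict_apply measurableSet_Ioo,
        Set.inter_eq_left.2 hsub]
    _ ≤ _ := MeasureTheory.measure_mono hlt

/-- with pairwise distinct demands, for a clean optimal pair
`(A, B)` and any `t` avoiding all the values `b i`, `c i`, the numbers of
intervals of `A` resp. `B` strictly containing `t` differ by at most 1. -/
theorem stmt10 (n : ℕ) (hn : 1 ≤ n) (b c d : Fin n → ℝ)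
    (hb : ∀ i, 0 ≤ b i) (hbc : ∀ i, b i ≤ c i) (hd : ∀ j, 0 ≤ d j)
    (hd_distinct : Function.Injective d) (k : ℕ)
    (A B : Finset (Fin n)) (hopt : OptimalPair b c d k A B)
    (hclean : Clean b c A B)
    (t : ℝ) (ht : ∀ i, t ≠ b i ∧ t ≠ c i) :
    |((A.filter (fun i => b i < t ∧ t < c i)).card : ℤ) -
      ((B.filter (fun i => b i < t ∧ t < c i)).card : ℤ)| ≤ 1 := by
  by_contra hcon
  have hcover : ∀ X : Finset (Fin n),
      (X.filter fun i => b i < t ∧ t < c i).card = coverNum b c X t := by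
    intro X
    unfold coverNum
    congr 1
    exact Finset.filter_congr fun i _ =>
      and_congr_left fun _ => ⟨le_of_lt, fun h => lt_of_le_of_ne h (ht i).1.symm⟩
  rw [hcover, hcover] at hcon
  obtain ⟨A', B', hcard, hbal⟩ := hclean.exists_balanced hbc
  have hle := hopt.cost_add_cost_le hcard
  set M : ℝ := ∑ i, c i with hM
  have hc0 : ∀ i, 0 ≤ c i := fun i => (hb i).trans (hbc i)
  have hcM : ∀ i, c i ≤ M := fun i =>
    Finset.single_le_sum (fun j _ => hc0 j) (Finset.mem_univ i)
  have hM0 : 0 ≤ M := Finset.sum_nonneg fun i _ => hc0 i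
  have he0 : ∀ X i, 0 ≤ effCost b c X i := fun X i => by
    unfold effCost; split_ifs; exacts [hb i, hc0 i]
  have heM : ∀ X i, effCost b c X i ≤ M := fun X i => by
    unfold effCost; split_ifs; exacts [(hbc i).trans (hcM i), hcM i]
  obtain ⟨i, hi⟩ : ∃ i, b i ≤ t ∧ t < c i := by
    by_contra! hno
    have : ∀ X, coverNum b c X t = 0 := fun X =>
      Finset.card_eq_zero.2 (Finset.filter_eq_empty_iff.2 fun i _ h => (hno i h.1).not_gt h.2)
    simp [this] at hcon
  set σ := Tuple.sort d
  have hσ : StrictMono (d ∘ σ) :=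
    (Tuple.monotone_sort d).strictMono_of_injective (hd_distinct.comp σ.injective)
  set D : ℕ → ℝ := fun m => if h : m < n then d (σ ⟨m, h⟩) else 0 with hDdef
  have hD0 : ∀ m, 0 ≤ D m := fun m => by
    simp only [hDdef]; split_ifs; exacts [hd _, le_rfl]
  have hD : ∀ m : Fin n, D m = d (σ m) := fun m => by simp [hDdef]
  have hmono : StrictMonoOn D (Set.Iio n) := by
    intro x hx y hy hxy
    simp only [Set.mem_Iio] at hx hy
    simp only [hDdef, hx, hy, dif_pos]
    exact hσ (Fin.mk_lt_mk.2 hxy)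
  have hcost : ∀ X, cost b c d X = _ := fun X =>
    cost_eq_integral b c d X (he0 X) (heM X) hD0 hmono.monotoneOn σ hD hM0
  have hintegrable : ∀ X, IntervalIntegrable
      (fun s => ∑ m ∈ Finset.range (numAbove (effCost b c X) s), D m)
      MeasureTheory.volume 0 M :=
    fun X => (sum_range_numAbove_antitone _ hD0).intervalIntegrable
  obtain ⟨t', htt', hconst⟩ := exists_gt_numAbove_eq b c t
  refine hle.not_gt ?_
  rw [hcost, hcost, hcost, hcost, ← intervalIntegral.integral_add (hintegrable _) (hintegrable _),
    ← intervalIntegral.integral_add (hintegrable _) (hintegrable _)]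
  have hnum := fun X s => numAbove_add_coverNum hbc X s
  refine integral_lt_integral_of_le_of_lt_const ((hintegrable _).add (hintegrable _))
    ((hintegrable _).add (hintegrable _))
    (t := t) (t' := min t' M) (fun s => ?_) ((hb i).trans hi.1)
    (lt_min htt' (hi.2.trans_le (hcM i))) (min_le_right _ _)
    (sum_range_add_sum_range_balanced_lt hmono (p' := numAbove (effCost b c A') t)
      (q' := numAbove (effCost b c B') t) (p := numAbove (effCost b c A) t)
      (q := numAbove (effCost b c B) t) ?_ ?_ ?_ (numAbove_le _ _) (numAbove_le _ _) ?_)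
    (fun s hs hs' => ?_) (fun s hs hs' => ?_)
  · obtain ⟨h1, h2⟩ := hbal s
    have hA := hnum A s
    have hB := hnum B s
    have hA' := hnum A' s
    have hB' := hnum B' s
    rw [abs_le] at h2
    exact sum_range_add_sum_range_balanced_le hmono (by omega) (by omega) (by omega)
      (numAbove_le _ _) (numAbove_le _ _)
  iterate 4
    obtain ⟨h1, h2⟩ := hbal t
    have hA := hnum A t
    have hB := hnum B t
    have hA' := hnum A' t
    have hB' := hnum B' t
    rw [abs_le] at h2 hcon
    omega
  · have hs'' := hs'.trans_le (min_le_left _ _)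
    simp only [hconst s hs hs'']
  · have hs'' := hs'.trans_le (min_le_left _ _)
    simp only [hconst s hs hs'']
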